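/- Let φ : ℝ → ℝ be a C^∞ function with φ''(1) = 0, and let k₁, k₂, h₁, h₂ be real numbers such that φ'(1)·(3√2·(h₁+h₂) + 4k₁k₂ − 6k₁² − 6k₂²) + 2φ'''(1)·(k₁+k₂)² > 0. Let Ω ⊆ ℝ² be open with (0,0) ∈ Ω, T > 0, and let u ∈ C²(Ω×[0,T)) satisfy u_t = div(φ'(|∇u|)·∇u/|∇u|) at every point where ∇u ≠ 0, with u(x,y,0) = u₀(x,y) where u₀ is of class C³ and u₀(x,y) = (√2/2)x + (√2/2)y + k₁x² + k₂y² + h₁x³ + h₂y³ + o((x²+y²)^{3/2}) as (x,y) → (0,0). Then there exists t₀ ∈ (0,T) such that |∇u(0,0,t)| > 1 for all t ∈ (0,t₀). -/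

import Mathlib

open Asymptotics Filter Topology

/-- squared norm of the spatial gradient of `u = u(x,y,t)` -/
noncomputable def gradSqT (u : ℝ → ℝ → ℝ → ℝ) (x y t : ℝ) : ℝ :=
  (deriv (fun s => u s y t) x) ^ 2 + (deriv (fun s => u x s t) y) ^ 2

/-- first component of the Perona–Malik flux `φ'(|∇u|)·∇u/|∇u|` -/
noncomputable def pmFlux1 (φ : ℝ → ℝ) (u : ℝ → ℝ → ℝ → ℝ) (x y t : ℝ) : ℝ :=
  deriv φ (Real.sqrt (gradSqT u x y t)) * (deriv (fun s => u s y t) x) /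
    Real.sqrt (gradSqT u x y t)

/-- second component of the Perona–Malik flux `φ'(|∇u|)·∇u/|∇u|` -/
noncomputable def pmFlux2 (φ : ℝ → ℝ) (u : ℝ → ℝ → ℝ → ℝ) (x y t : ℝ) : ℝ :=
  deriv φ (Real.sqrt (gradSqT u x y t)) * (deriv (fun s => u x s t) y) /
    Real.sqrt (gradSqT u x y t)

/-- If `f' = o(sⁿ)` at `0` and `f 0 = 0`, then `f = o(sⁿ⁺¹)`. -/
lemma isLittleO_pow_succ_of_hasDerivAt {f f' : ℝ → ℝ} {n : ℕ}
    (hf : ∀ᶠ s in 𝓝 (0 : ℝ), HasDerivAt f (f' s) s) (hf0 : f 0 = 0)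
    (hf' : f' =o[𝓝 0] fun s : ℝ => s ^ n) :
    f =o[𝓝 0] fun s : ℝ => s ^ (n + 1) := by
  rw [isLittleO_iff]
  intro c hc
  obtain ⟨ε, hε, hb⟩ := Metric.eventually_nhds_iff_ball.1 (hf.and (isLittleO_iff.1 hf' hc))
  filter_upwards [Metric.ball_mem_nhds (0 : ℝ) hε] with s hs
  have hsub : Metric.closedBall (0 : ℝ) |s| ⊆ Metric.ball 0 ε :=
    Metric.closedBall_subset_ball (by simpa using hs)
  have key := (convex_closedBall (0 : ℝ) |s|).norm_image_sub_le_of_norm_hasDerivWithin_le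
    (f := f) (f' := f') (C := c * |s| ^ n) (x := 0) (y := s)
    (fun x hx => (hb x (hsub hx)).1.hasDerivWithinAt)
    (fun x hx => by
      refine (hb x (hsub hx)).2.trans ?_
      rw [norm_pow]
      have : ‖x‖ ≤ |s| := by simpa using hx
      gcongr)
    (by simp) (by simp)
  simpa [hf0, pow_succ, mul_assoc, abs_mul] using key

/-- A continuous `r` with `sᵏ r(s) = o(sᵏ)` vanishes at `0`. -/
lemma eq_zero_of_pow_mul_isLittleO {r : ℝ → ℝ} (hr : ContinuousAt r 0) (k : ℕ)
    (h : (fun s : ℝ => s ^ k * r s) =o[𝓝 0] fun s : ℝ => s ^ k) : r 0 = 0 := by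
  have h1 := (h.mono (nhdsWithin_le_nhds (s := {0}ᶜ))).tendsto_div_nhds_zero
  have h2 : Tendsto r (𝓝[≠] (0 : ℝ)) (𝓝 0) := by
    refine h1.congr' ?_
    filter_upwards [self_mem_nhdsWithin] with s hs
    have : s ≠ 0 := hs
    field_simp
  exact tendsto_nhds_unique (hr.tendsto.mono_left nhdsWithin_le_nhds) h2

/-- A cubic polynomial that is `o(s³)` at `0` has vanishing coefficients. -/
lemma cubic_coeff_eq_zero {a b c d : ℝ}
    (h : (fun s : ℝ => a + b * s + c * s ^ 2 + d * s ^ 3) =o[𝓝 0] fun s : ℝ => s ^ 3) :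
    a = 0 ∧ b = 0 ∧ c = 0 ∧ d = 0 := by
  have hO : ∀ k ≤ 3, (fun s : ℝ => s ^ 3) =O[𝓝 0] fun s : ℝ => s ^ k := fun k hk =>
    IsBigO.of_bound 1 <| by
      filter_upwards [Metric.ball_mem_nhds (0 : ℝ) one_pos] with s hs
      have hs1 : |s| ≤ 1 := (by simpa using hs : |s| < 1).le
      simpa using pow_le_pow_of_le_one (abs_nonneg s) hs1 hk
  have ha : a + b * 0 + c * 0 ^ 2 + d * 0 ^ 3 = 0 :=
    eq_zero_of_pow_mul_isLittleO (r := fun s => a + b * s + c * s ^ 2 + d * s ^ 3)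
      (by fun_prop) 0 ((h.trans_isBigO (hO 0 (by norm_num))).congr_left fun s => by ring)
  replace ha : a = 0 := by linarith
  have hb : b + c * 0 + d * 0 ^ 2 = 0 :=
    eq_zero_of_pow_mul_isLittleO (r := fun s => b + c * s + d * s ^ 2) (by fun_prop) 1
      ((h.trans_isBigO (hO 1 (by norm_num))).congr_left fun s => by rw [ha]; ring)
  replace hb : b = 0 := by linarith
  have hc : c + d * 0 = 0 :=
    eq_zero_of_pow_mul_isLittleO (r := fun s => c + d * s) (by fun_prop) 2
      ((h.trans_isBigO (hO 2 (by norm_num))).congr_left fun s => by rw [ha, hb]; ring)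
  replace hc : c = 0 := by linarith
  have hd : d = 0 :=
    eq_zero_of_pow_mul_isLittleO (r := fun _ => d) continuousAt_const 3
      ((h.trans_isBigO (hO 3 le_rfl)).congr_left fun s => by rw [ha, hb, hc]; ring)
  exact ⟨ha, hb, hc, hd⟩

/-- Uniqueness of the third order Taylor expansion at `0` on the line. -/
lemma taylor_coeff_unique {g g₁ g₂ : ℝ → ℝ} {g₃ c₁ c₂ c₃ : ℝ}
    (h₀ : ∀ᶠ s in 𝓝 (0 : ℝ), HasDerivAt g (g₁ s) s)
    (h₁ : ∀ᶠ s in 𝓝 (0 : ℝ), HasDerivAt g₁ (g₂ s) s) (h₂ : HasDerivAt g₂ g₃ 0)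
    (ho : (fun s : ℝ => g s - (c₁ * s + c₂ * s ^ 2 + c₃ * s ^ 3)) =o[𝓝 0] fun s : ℝ => s ^ 3) :
    g₁ 0 = c₁ ∧ g₂ 0 = 2 * c₂ ∧ g₃ = 6 * c₃ := by
  have e2 : (fun s => g₂ s - g₂ 0 - g₃ * s) =o[𝓝 0] fun s : ℝ => s ^ 1 := by
    have := hasDerivAt_iff_isLittleO.1 h₂
    simpa [mul_comm] using this
  have e1 : (fun s => g₁ s - g₁ 0 - g₂ 0 * s - g₃ / 2 * s ^ 2) =o[𝓝 0] fun s : ℝ => s ^ 2 := by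
    refine isLittleO_pow_succ_of_hasDerivAt ?_ (by simp) e2
    filter_upwards [h₁] with s hs
    exact (((hs.sub_const (g₁ 0)).sub ((hasDerivAt_id s).const_mul (g₂ 0))).sub
      (((hasDerivAt_id s).pow 2).const_mul (g₃ / 2))).congr_deriv (by simp; ring)
  have e0 : (fun s => g s - g 0 - g₁ 0 * s - g₂ 0 / 2 * s ^ 2 - g₃ / 6 * s ^ 3) =o[𝓝 0]
      fun s : ℝ => s ^ 3 := by
    refine isLittleO_pow_succ_of_hasDerivAt ?_ (by simp) e1
    filter_upwards [h₀] with s hs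
    exact ((((hs.sub_const (g 0)).sub ((hasDerivAt_id s).const_mul (g₁ 0))).sub
      (((hasDerivAt_id s).pow 2).const_mul (g₂ 0 / 2))).sub
      (((hasDerivAt_id s).pow 3).const_mul (g₃ / 6))).congr_deriv (by simp; ring)
  obtain ⟨-, hb, hc, hd⟩ := cubic_coeff_eq_zero (a := g 0) (b := g₁ 0 - c₁)
    (c := g₂ 0 / 2 - c₂) (d := g₃ / 6 - c₃) ((ho.sub e0).congr_left fun s => by ring)
  exact ⟨by linarith, by linarith, by linarith⟩

/-- The directional derivatives at `0` of a `C³` function with a third order expansion. -/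
lemma fderiv_of_taylor {E : Type*} [NormedAddCommGroup E] [NormedSpace ℝ E] {f : E → ℝ}
    (hf : ContDiffAt ℝ 3 f 0) (v : E) {c₁ c₂ c₃ : ℝ}
    (ho : (fun s : ℝ => f (s • v) - (c₁ * s + c₂ * s ^ 2 + c₃ * s ^ 3)) =o[𝓝 0]
      fun s : ℝ => s ^ 3) :
    fderiv ℝ f 0 v = c₁ ∧ fderiv ℝ (fderiv ℝ f) 0 v v = 2 * c₂ ∧
      fderiv ℝ (fderiv ℝ (fderiv ℝ f)) 0 v v v = 6 * c₃ := by
  have hf1 : ContDiffAt ℝ 2 (fderiv ℝ f) 0 := hf.fderiv_right (by norm_num)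
  have hf2 : ContDiffAt ℝ 1 (fderiv ℝ (fderiv ℝ f)) 0 := hf1.fderiv_right (by norm_num)
  have hline : ∀ s : ℝ, HasDerivAt (fun s : ℝ => s • v) v s := fun s => by
    simpa using (hasDerivAt_id s).smul_const v
  have ht : Tendsto (fun s : ℝ => s • v) (𝓝 0) (𝓝 0) := by
    simpa using (hline 0).continuousAt.tendsto
  have h0 : ∀ᶠ s in 𝓝 (0 : ℝ), HasDerivAt (fun s : ℝ => f (s • v)) (fderiv ℝ f (s • v) v) s := by
    filter_upwards [ht.eventually (hf.eventually (by simp))] with s hs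
    exact (hs.differentiableAt (by simp)).hasFDerivAt.comp_hasDerivAt s (hline s)
  have h1 : ∀ᶠ s in 𝓝 (0 : ℝ), HasDerivAt (fun s : ℝ => fderiv ℝ f (s • v) v)
      (fderiv ℝ (fderiv ℝ f) (s • v) v v) s := by
    filter_upwards [ht.eventually (hf1.eventually (by simp))] with s hs
    have h : HasDerivAt (fun s : ℝ => fderiv ℝ f (s • v)) (fderiv ℝ (fderiv ℝ f) (s • v) v) s :=
      (hs.differentiableAt (by simp)).hasFDerivAt.comp_hasDerivAt s (hline s)
    simpa using h.clm_apply (hasDerivAt_const s v)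
  have h2 : HasDerivAt (fun s : ℝ => fderiv ℝ (fderiv ℝ f) (s • v) v v)
      (fderiv ℝ (fderiv ℝ (fderiv ℝ f)) 0 v v v) 0 := by
    have h : HasDerivAt (fun s : ℝ => fderiv ℝ (fderiv ℝ f) (s • v))
        (fderiv ℝ (fderiv ℝ (fderiv ℝ f)) 0 v) 0 := by
      have := (hf2.differentiableAt (by simp)).hasFDerivAt
      exact this.comp_hasDerivAt_of_eq (0 : ℝ) (hline 0) (by simp)
    simpa using (h.clm_apply (hasDerivAt_const (0 : ℝ) v)).clm_apply (hasDerivAt_const (0 : ℝ) v)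
  simpa using taylor_coeff_unique h0 h1 h2 ho

/-- The third derivative of a `C³` function is symmetric. -/
lemma fderiv_fderiv_fderiv_symm {E : Type*} [NormedAddCommGroup E] [NormedSpace ℝ E] {f : E → ℝ}
    {x : E} (hf : ContDiffAt ℝ 3 f x) (v w z : E) :
    fderiv ℝ (fderiv ℝ (fderiv ℝ f)) x v w z = fderiv ℝ (fderiv ℝ (fderiv ℝ f)) x w v z ∧
      fderiv ℝ (fderiv ℝ (fderiv ℝ f)) x v w z =
        fderiv ℝ (fderiv ℝ (fderiv ℝ f)) x v z w := by
  have hf1 : ContDiffAt ℝ 2 (fderiv ℝ f) x := hf.fderiv_right (by norm_num)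
  have hf2 : ContDiffAt ℝ 1 (fderiv ℝ (fderiv ℝ f)) x := hf1.fderiv_right (by norm_num)
  constructor
  · rw [(hf1.isSymmSndFDerivAt (by simp)) v w]
  · have h := (hf2.differentiableAt (by simp)).hasFDerivAt
    have e : ∀ a b : E, HasFDerivAt (fun y => fderiv ℝ (fderiv ℝ f) y a b)
        (((fderiv ℝ (fderiv ℝ (fderiv ℝ f)) x).flip a).flip b) x := fun a b => by
      have := (h.clm_apply (hasFDerivAt_const a x)).clm_apply (hasFDerivAt_const b x)
      refine this.congr_fderiv ?_
      ext; simp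
    have hs : (fun y => fderiv ℝ (fderiv ℝ f) y w z) =ᶠ[𝓝 x]
        fun y => fderiv ℝ (fderiv ℝ f) y z w := by
      filter_upwards [hf.eventually (by simp)] with y hy
      exact (hy.of_le (by norm_num)).isSymmSndFDerivAt (n := 2) (by simp) w z
    have := (e w z).unique ((e z w).congr_of_eventuallyEq hs)
    simpa using congrArg (fun L => L v) this

/-- Derivatives at the origin, in the frame `(1,0)`, `(0,1)`, of a `C³` function with the given
third order expansion. -/
lemma taylor_plane {f : ℝ × ℝ → ℝ} (hf : ContDiffAt ℝ 3 f 0) {a k₁ k₂ h₁ h₂ : ℝ}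
    (ho : (fun p : ℝ × ℝ => f p - (a * p.1 + a * p.2 + k₁ * p.1 ^ 2 + k₂ * p.2 ^ 2 +
          h₁ * p.1 ^ 3 + h₂ * p.2 ^ 3)) =o[𝓝 0]
        fun p : ℝ × ℝ => (p.1 ^ 2 + p.2 ^ 2) ^ ((3 : ℝ) / 2)) :
    (fderiv ℝ f 0 (1, 0) = a ∧ fderiv ℝ f 0 (0, 1) = a) ∧
    (fderiv ℝ (fderiv ℝ f) 0 (1, 0) (1, 0) = 2 * k₁ ∧
      fderiv ℝ (fderiv ℝ f) 0 (0, 1) (0, 1) = 2 * k₂ ∧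
      fderiv ℝ (fderiv ℝ f) 0 (1, 0) (0, 1) = 0 ∧
      fderiv ℝ (fderiv ℝ f) 0 (0, 1) (1, 0) = 0) ∧
    (fderiv ℝ (fderiv ℝ (fderiv ℝ f)) 0 (1, 1) (1, 0) (1, 0) = 6 * h₁ ∧
      fderiv ℝ (fderiv ℝ (fderiv ℝ f)) 0 (1, 1) (0, 1) (0, 1) = 6 * h₂ ∧
      fderiv ℝ (fderiv ℝ (fderiv ℝ f)) 0 (1, 1) (1, 0) (0, 1) = 0 ∧
      fderiv ℝ (fderiv ℝ (fderiv ℝ f)) 0 (1, 1) (0, 1) (1, 0) = 0) := by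
  have hdir : ∀ x y : ℝ, (fun s : ℝ => f (s • (x, y)) - ((a * x + a * y) * s +
      (k₁ * x ^ 2 + k₂ * y ^ 2) * s ^ 2 + (h₁ * x ^ 3 + h₂ * y ^ 3) * s ^ 3)) =o[𝓝 0]
      fun s : ℝ => s ^ 3 := by
    intro x y
    have ht : Tendsto (fun s : ℝ => s • (x, y)) (𝓝 0) (𝓝 0) := by
      have : ContinuousAt (fun s : ℝ => s • (x, y)) 0 := by fun_prop
      simpa [ContinuousAt] using this
    have h1 := (ho.comp_tendsto ht).congr_left (f₂ := fun s : ℝ => f (s • (x, y)) -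
      ((a * x + a * y) * s + (k₁ * x ^ 2 + k₂ * y ^ 2) * s ^ 2 +
        (h₁ * x ^ 3 + h₂ * y ^ 3) * s ^ 3)) (fun s => by simp; ring)
    refine h1.trans_isBigO (IsBigO.of_bound ((x ^ 2 + y ^ 2) ^ ((3 : ℝ) / 2))
      (Eventually.of_forall fun s => le_of_eq ?_))
    have e1 : (s * x) ^ 2 + (s * y) ^ 2 = s ^ 2 * (x ^ 2 + y ^ 2) := by ring
    have e2 : (s ^ 2 : ℝ) ^ ((3 : ℝ) / 2) = |s| ^ 3 := by
      rw [← sq_abs, ← Real.rpow_natCast, ← Real.rpow_mul (abs_nonneg s),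
        ← Real.rpow_natCast]
      norm_num
    simp only [Function.comp, Prod.smul_mk, smul_eq_mul, e1]
    rw [Real.mul_rpow (by positivity) (by positivity), e2, Real.norm_of_nonneg (by positivity),
      norm_pow, Real.norm_eq_abs, mul_comm]
  have hs2 : fderiv ℝ (fderiv ℝ f) 0 (1, 0) (0, 1) = fderiv ℝ (fderiv ℝ f) 0 (0, 1) (1, 0) :=
    (hf.of_le (by norm_num)).isSymmSndFDerivAt (n := 2) (by simp) _ _
  have hs3 := fderiv_fderiv_fderiv_symm hf
  obtain ⟨p1, p2, p3⟩ := fderiv_of_taylor hf _ (hdir 1 0)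
  obtain ⟨q1, q2, q3⟩ := fderiv_of_taylor hf _ (hdir 0 1)
  obtain ⟨-, r2, r3⟩ := fderiv_of_taylor hf _ (hdir 1 1)
  obtain ⟨-, -, m3⟩ := fderiv_of_taylor hf _ (hdir 1 (-1))
  have e11 : ((1, 1) : ℝ × ℝ) = (1, 0) + (0, 1) := by simp
  have e12 : ((1, -1) : ℝ × ℝ) = (1, 0) - (0, 1) := by simp
  rw [e12] at m3
  rw [e11] at r2 r3 ⊢
  generalize ((1, 0) : ℝ × ℝ) = e at *
  generalize ((0, 1) : ℝ × ℝ) = e' at *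
  simp only [map_add, map_sub, add_apply,
    sub_apply] at r2 r3 m3 ⊢
  have s1 := (hs3 e e e').2
  have s2 := (hs3 e e' e).1
  have s3 := (hs3 e' e' e).2
  have s4 := (hs3 e' e e').1
  refine ⟨⟨by linarith, by linarith⟩, ⟨by linarith, by linarith, by linarith, by linarith⟩,
    by linarith, by linarith, by linarith, by linarith⟩

/-- The derivative in `g` of `φ'(√g)/√g`. -/
noncomputable def pmCoeffDeriv (φ : ℝ → ℝ) (g : ℝ) : ℝ :=
  (deriv (deriv φ) √g * √g - deriv φ √g) / (2 * √g ^ 3)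

lemma hasDerivAt_pmCoeff {φ : ℝ → ℝ} (hφ : ContDiff ℝ (⊤ : ℕ∞) φ) {g : ℝ} (hg : 0 < g) :
    HasDerivAt (fun g => deriv φ √g / √g) (pmCoeffDeriv φ g) g := by
  have h1 : ContDiff ℝ (⊤ : ℕ∞) (deriv φ) := (contDiff_infty_iff_deriv.1 hφ).2
  have hs : 0 < √g := Real.sqrt_pos.2 hg
  have hr := Real.hasDerivAt_sqrt hg.ne'
  have := (((h1.differentiable (by simp)) √g).hasDerivAt.comp g hr).div hr hs.ne'
  refine this.congr_deriv ?_
  simp only [pmCoeffDeriv, Function.comp]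
  field_simp

lemma hasDerivAt_pmCoeffDeriv_one {φ : ℝ → ℝ} (hφ : ContDiff ℝ (⊤ : ℕ∞) φ)
    (h2 : deriv (deriv φ) 1 = 0) :
    HasDerivAt (pmCoeffDeriv φ)
      (deriv (deriv (deriv φ)) 1 / 4 + 3 / 4 * deriv φ 1) 1 := by
  have h1 : ContDiff ℝ (⊤ : ℕ∞) (deriv φ) := (contDiff_infty_iff_deriv.1 hφ).2
  have h1' : ContDiff ℝ (⊤ : ℕ∞) (deriv (deriv φ)) := (contDiff_infty_iff_deriv.1 h1).2
  have hr := Real.hasDerivAt_sqrt (one_ne_zero (α := ℝ))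
  have d1 := ((h1.differentiable (by simp)) √1).hasDerivAt.comp 1 hr
  have d2 := ((h1'.differentiable (by simp)) √1).hasDerivAt.comp 1 hr
  have := ((d2.mul hr).sub d1).div ((hr.pow 3).const_mul 2) (by simp)
  refine this.congr_deriv ?_
  simp [h2]
  ring

/-- Chain rule for a component `φ'(√(p²+q²)) p / √(p²+q²)` of the flux along a line. -/
lemma hasDerivAt_flux {φ : ℝ → ℝ} (hφ : ContDiff ℝ (⊤ : ℕ∞) φ) {p q w : ℝ → ℝ} {p' q' w' x : ℝ}
    (hp : HasDerivAt p p' x) (hq : HasDerivAt q q' x) (hw : HasDerivAt w w' x)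
    (hg : 0 < p x ^ 2 + q x ^ 2) :
    HasDerivAt (fun s => deriv φ √(p s ^ 2 + q s ^ 2) * w s / √(p s ^ 2 + q s ^ 2))
      (pmCoeffDeriv φ (p x ^ 2 + q x ^ 2) * (2 * p x * p' + 2 * q x * q') * w x +
        deriv φ √(p x ^ 2 + q x ^ 2) / √(p x ^ 2 + q x ^ 2) * w') x := by
  have hG : HasDerivAt (fun s => p s ^ 2 + q s ^ 2) (2 * p x * p' + 2 * q x * q') x :=
    ((hp.pow 2).add (hq.pow 2)).congr_deriv (by simp)
  have := ((hasDerivAt_pmCoeff hφ hg).comp x hG).mul hw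
  refine (this.congr_of_eventuallyEq (Eventually.of_forall fun s => ?_))
  simp only [Pi.mul_apply, Function.comp]
  ring

/-- The divergence of the flux at time `0`, in terms of the derivatives of the initial datum. -/
lemma pmFlux_divergence {φ : ℝ → ℝ} (hφ : ContDiff ℝ (⊤ : ℕ∞) φ) {Ω : Set (ℝ × ℝ)} (hΩ : IsOpen Ω)
    {u : ℝ → ℝ → ℝ → ℝ} {f : ℝ × ℝ → ℝ} (hf : ContDiffOn ℝ 2 f Ω)
    (hu : ∀ x y : ℝ, (x, y) ∈ Ω → u x y 0 = f (x, y)) {x y p q a b c d g : ℝ} (hz : (x, y) ∈ Ω)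
    (hp : fderiv ℝ f (x, y) (1, 0) = p) (hq : fderiv ℝ f (x, y) (0, 1) = q)
    (ha : fderiv ℝ (fderiv ℝ f) (x, y) (1, 0) (1, 0) = a)
    (hb : fderiv ℝ (fderiv ℝ f) (x, y) (1, 0) (0, 1) = b)
    (hc : fderiv ℝ (fderiv ℝ f) (x, y) (0, 1) (1, 0) = c)
    (hd : fderiv ℝ (fderiv ℝ f) (x, y) (0, 1) (0, 1) = d)
    (hg : p ^ 2 + q ^ 2 = g) (hg0 : 0 < g) :
    deriv (fun s => pmFlux1 φ u s y 0) x + deriv (fun s => pmFlux2 φ u x s 0) y =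
      (pmCoeffDeriv φ g * (2 * p * a + 2 * q * b) * p + deriv φ √g / √g * a) +
        (pmCoeffDeriv φ g * (2 * p * c + 2 * q * d) * q + deriv φ √g / √g * d) := by
  have hline1 : ∀ x y : ℝ, HasDerivAt (fun s : ℝ => (s, y)) (1, 0) x := fun x y =>
    (hasDerivAt_id x).prodMk (hasDerivAt_const x y)
  have hline2 : ∀ x y : ℝ, HasDerivAt (fun s : ℝ => (x, s)) (0, 1) y := fun x y =>
    (hasDerivAt_const y x).prodMk (hasDerivAt_id y)
  have hev1 : ∀ x y : ℝ, (x, y) ∈ Ω → ∀ᶠ s in 𝓝 x, (s, y) ∈ Ω := fun x y h =>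
    (hline1 x y).continuousAt.eventually (hΩ.mem_nhds h)
  have hev2 : ∀ x y : ℝ, (x, y) ∈ Ω → ∀ᶠ s in 𝓝 y, (x, s) ∈ Ω := fun x y h =>
    (hline2 x y).continuousAt.eventually (hΩ.mem_nhds h)
  have hdf : ∀ z ∈ Ω, HasFDerivAt f (fderiv ℝ f z) z := fun z h =>
    ((hf.contDiffAt (hΩ.mem_nhds h)).differentiableAt (by simp)).hasFDerivAt
  have hux : ∀ x y : ℝ, (x, y) ∈ Ω →
      deriv (fun s => u s y 0) x = fderiv ℝ f (x, y) (1, 0) := fun x y h =>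
    (((hdf _ h).comp_hasDerivAt x (hline1 x y)).congr_of_eventuallyEq
      ((hev1 x y h).mono fun s hs => hu s y hs)).deriv
  have huy : ∀ x y : ℝ, (x, y) ∈ Ω →
      deriv (fun s => u x s 0) y = fderiv ℝ f (x, y) (0, 1) := fun x y h =>
    (((hdf _ h).comp_hasDerivAt y (hline2 x y)).congr_of_eventuallyEq
      ((hev2 x y h).mono fun s hs => hu x s hs)).deriv
  have hdf2 : HasFDerivAt (fderiv ℝ f) (fderiv ℝ (fderiv ℝ f) (x, y)) (x, y) :=
    (((hf.contDiffAt (hΩ.mem_nhds hz)).fderiv_right (m := 1) (by norm_num)).differentiableAt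
      (by simp)).hasFDerivAt
  have l1 : ∀ w : ℝ × ℝ, HasDerivAt (fun s => fderiv ℝ f (s, y) w)
      (fderiv ℝ (fderiv ℝ f) (x, y) (1, 0) w) x := fun w => by
    have h : HasDerivAt (fun s => fderiv ℝ f (s, y)) (fderiv ℝ (fderiv ℝ f) (x, y) (1, 0)) x :=
      hdf2.comp_hasDerivAt x (hline1 x y)
    simpa using h.clm_apply (hasDerivAt_const x w)
  have l2 : ∀ w : ℝ × ℝ, HasDerivAt (fun s => fderiv ℝ f (x, s) w)
      (fderiv ℝ (fderiv ℝ f) (x, y) (0, 1) w) y := fun w => by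
    have h : HasDerivAt (fun s => fderiv ℝ f (x, s)) (fderiv ℝ (fderiv ℝ f) (x, y) (0, 1)) y :=
      hdf2.comp_hasDerivAt y (hline2 x y)
    simpa using h.clm_apply (hasDerivAt_const y w)
  subst hp hq ha hb hc hd hg
  congr 1
  · refine HasDerivAt.deriv ((hasDerivAt_flux hφ (l1 (1, 0)) (l1 (0, 1)) (l1 (1, 0))
      hg0).congr_of_eventuallyEq ?_)
    filter_upwards [hev1 x y hz] with s hs
    simp only [pmFlux1, gradSqT, hux s y hs, huy s y hs]
  · refine HasDerivAt.deriv ((hasDerivAt_flux hφ (l2 (1, 0)) (l2 (0, 1)) (l2 (0, 1))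
      hg0).congr_of_eventuallyEq ?_)
    filter_upwards [hev2 x y hz] with s hs
    simp only [pmFlux2, gradSqT, hux x s hs, huy x s hs]

/-- Derivative along a curve of the expanded divergence of the flux, at a point where `|∇u| = 1`
and the gradient points in the diagonal direction. -/
lemma hasDerivAt_divergence {φ : ℝ → ℝ} (hφ : ContDiff ℝ (⊤ : ℕ∞) φ)
    (h2 : deriv (deriv φ) 1 = 0) {p q a b c d : ℝ → ℝ} {α k₁ k₂ h₁ h₂ : ℝ} (hα : 2 * α ^ 2 = 1)
    (hp : HasDerivAt p (2 * k₁) 0) (hq : HasDerivAt q (2 * k₂) 0)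
    (ha : HasDerivAt a (6 * h₁) 0) (hb : HasDerivAt b 0 0) (hc : HasDerivAt c 0 0)
    (hd : HasDerivAt d (6 * h₂) 0) (hp0 : p 0 = α) (hq0 : q 0 = α) (ha0 : a 0 = 2 * k₁)
    (hb0 : b 0 = 0) (hc0 : c 0 = 0) (hd0 : d 0 = 2 * k₂) :
    HasDerivAt (fun s =>
      (pmCoeffDeriv φ (p s ^ 2 + q s ^ 2) * (2 * p s * a s + 2 * q s * b s) * p s +
          deriv φ √(p s ^ 2 + q s ^ 2) / √(p s ^ 2 + q s ^ 2) * a s) +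
        (pmCoeffDeriv φ (p s ^ 2 + q s ^ 2) * (2 * p s * c s + 2 * q s * d s) * q s +
          deriv φ √(p s ^ 2 + q s ^ 2) / √(p s ^ 2 + q s ^ 2) * d s))
      (α * (deriv φ 1 * (6 * α * (h₁ + h₂) + 4 * k₁ * k₂ - 6 * k₁ ^ 2 - 6 * k₂ ^ 2) +
        2 * deriv (deriv (deriv φ)) 1 * (k₁ + k₂) ^ 2)) 0 := by
  have hg0 : p 0 ^ 2 + q 0 ^ 2 = 1 := by rw [hp0, hq0]; linarith
  have hg1 : α ^ 2 + α ^ 2 = 1 := by linarith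
  have hg : HasDerivAt (fun s => p s ^ 2 + q s ^ 2) (4 * α * (k₁ + k₂)) 0 :=
    ((hp.pow 2).add (hq.pow 2)).congr_deriv (by simp [hp0, hq0]; ring)
  have hH : HasDerivAt (fun s => deriv φ √(p s ^ 2 + q s ^ 2) / √(p s ^ 2 + q s ^ 2))
      (pmCoeffDeriv φ 1 * (4 * α * (k₁ + k₂))) 0 :=
    (hasDerivAt_pmCoeff hφ one_pos).comp_of_eq (0 : ℝ) hg hg0.symm
  have hK : HasDerivAt (fun s => pmCoeffDeriv φ (p s ^ 2 + q s ^ 2))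
      ((deriv (deriv (deriv φ)) 1 / 4 + 3 / 4 * deriv φ 1) * (4 * α * (k₁ + k₂))) 0 :=
    (hasDerivAt_pmCoeffDeriv_one hφ h2).comp_of_eq (0 : ℝ) hg hg0.symm
  have hK1 : pmCoeffDeriv φ 1 = -deriv φ 1 / 2 := by simp [pmCoeffDeriv, h2]
  have key := (((hK.mul (((hp.const_mul 2).mul ha).add ((hq.const_mul 2).mul hb))).mul hp).add
    (hH.mul ha)).add
    (((hK.mul (((hp.const_mul 2).mul hc).add ((hq.const_mul 2).mul hd))).mul hq).add (hH.mul hd))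
  refine key.congr_deriv ?_
  simp only [Pi.mul_apply, Pi.add_apply, hp0, hq0, ha0, hb0, hc0, hd0, hg1, hK1,
    Real.sqrt_one]
  generalize deriv φ 1 = A
  generalize deriv (deriv (deriv φ)) 1 = B
  have hα' : α ^ 2 = 1 / 2 := by linarith
  have hα3 : α ^ 3 = α / 2 := by rw [pow_succ, hα']; ring
  ring_nf
  simp only [hα', hα3]
  ring

/-- A function equal to `1` at `0` with positive right derivative there exceeds `1` just after. -/
lemma exists_one_lt_of_hasDerivWithinAt {G : ℝ → ℝ} {G' T : ℝ} (hT : 0 < T)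
    (hG : HasDerivWithinAt G G' (Set.Ico 0 T) 0) (hG0 : G 0 = 1) (hpos : 0 < G') :
    ∃ t₀ : ℝ, 0 < t₀ ∧ t₀ < T ∧ ∀ t : ℝ, 0 < t → t < t₀ → 1 < G t := by
  have h1 : HasDerivWithinAt G G' (Set.Ioi 0) 0 :=
    ((hG.mono Set.Ioo_subset_Ico_self).mono_of_mem_nhdsWithin
      (Ioo_mem_nhdsGT hT))
  have h2 := (hasDerivWithinAt_iff_tendsto_slope' (by simp)).1 h1
  have h3 : ∀ᶠ t in 𝓝[>] (0 : ℝ), 1 < G t := by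
    filter_upwards [h2.eventually (lt_mem_nhds hpos), self_mem_nhdsWithin] with t ht ht0
    have ht0' : (0 : ℝ) < t := ht0
    rw [slope_def_field, hG0, sub_zero, div_pos_iff_of_pos_right ht0'] at ht
    linarith
  obtain ⟨ε, hε, hb⟩ := mem_nhdsGT_iff_exists_Ioo_subset.1 h3
  have hε0 : (0 : ℝ) < ε := hε
  exact ⟨min ε (T / 2), lt_min hε0 (by linarith), by
    linarith [min_le_right ε (T / 2)], fun t h0 ht => hb ⟨h0, ht.trans_le (min_le_left _ _)⟩⟩

/-- If `φ'(1)(3√2(h₁+h₂) + 4k₁k₂ - 6k₁² - 6k₂²) + 2φ'''(1)(k₁+k₂)² > 0`, then for any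
`C²` solution of `u_t = div(φ'(|∇u|)·∇u/|∇u|)` with initial datum `u₀` having the
given Taylor expansion at the origin, the origin is supercritical (`|∇u| > 1`)
for all small positive times. -/
theorem origin_absorbed_by_supercritical_region
    (φ : ℝ → ℝ) (hφ : ContDiff ℝ (⊤ : ℕ∞) φ) (hφ2one : deriv (deriv φ) 1 = 0)
    (k₁ k₂ h₁ h₂ : ℝ)
    (hpos : deriv φ 1 * (3 * Real.sqrt 2 * (h₁ + h₂) + 4 * k₁ * k₂ - 6 * k₁ ^ 2 -
        6 * k₂ ^ 2) + 2 * deriv (deriv (deriv φ)) 1 * (k₁ + k₂) ^ 2 > 0)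
    (Ω : Set (ℝ × ℝ)) (hΩ : IsOpen Ω) (hΩ0 : ((0 : ℝ), (0 : ℝ)) ∈ Ω)
    (T : ℝ) (hT : 0 < T)
    (u : ℝ → ℝ → ℝ → ℝ) (u₀ : ℝ → ℝ → ℝ)
    -- `u ∈ C²(Ω×[0,T))`
    (huC2 : ContDiffOn ℝ 2 (fun p : ℝ × ℝ × ℝ => u p.1 p.2.1 p.2.2)
      {p : ℝ × ℝ × ℝ | (p.1, p.2.1) ∈ Ω ∧ p.2.2 ∈ Set.Ico 0 T})
    -- the equation holds at every point where `∇u ≠ 0`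
    (heq : ∀ x y t : ℝ, (x, y) ∈ Ω → t ∈ Set.Ico 0 T →
      (deriv (fun s => u s y t) x ≠ 0 ∨ deriv (fun s => u x s t) y ≠ 0) →
      HasDerivWithinAt (fun s => u x y s)
        (deriv (fun s => pmFlux1 φ u s y t) x + deriv (fun s => pmFlux2 φ u x s t) y)
        (Set.Ico 0 T) t)
    -- `u₀` is of class `C³` on `Ω` ...
    (hu₀C3 : ContDiffOn ℝ 3 (fun p : ℝ × ℝ => u₀ p.1 p.2) Ω)
    -- ... with the given third-order Taylor expansion at the origin
    (htaylor : (fun p : ℝ × ℝ => u₀ p.1 p.2 -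
        (Real.sqrt 2 / 2 * p.1 + Real.sqrt 2 / 2 * p.2 + k₁ * p.1 ^ 2 + k₂ * p.2 ^ 2 +
          h₁ * p.1 ^ 3 + h₂ * p.2 ^ 3)) =o[nhds ((0 : ℝ), (0 : ℝ))]
        fun p : ℝ × ℝ => (p.1 ^ 2 + p.2 ^ 2) ^ ((3 : ℝ) / 2))
    -- initial condition
    (hinit : ∀ x y : ℝ, (x, y) ∈ Ω → u x y 0 = u₀ x y) :
    ∃ t₀ : ℝ, 0 < t₀ ∧ t₀ < T ∧ ∀ t : ℝ, 0 < t → t < t₀ → 1 < gradSqT u 0 0 t := by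
  set f : ℝ × ℝ → ℝ := fun p => u₀ p.1 p.2 with hf_def
  set U : ℝ × ℝ × ℝ → ℝ := fun p => u p.1 p.2.1 p.2.2 with hU_def
  set α : ℝ := √2 / 2 with hα_def
  have hsq : √2 = 2 * α := by rw [hα_def]; ring
  have hα : 2 * α ^ 2 = 1 := by
    rw [hα_def, div_pow, Real.sq_sqrt (by norm_num)]; norm_num
  have hα0 : 0 < α := by positivity
  have hf3 : ∀ z ∈ Ω, ContDiffAt ℝ 3 f z := fun z hz => hu₀C3.contDiffAt (hΩ.mem_nhds hz)
  have hf0 : ContDiffAt ℝ 3 f 0 := hf3 _ hΩ0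
  obtain ⟨⟨hp0, hq0⟩, ⟨ha0, hd0, hb0, hc0⟩, ha1, hd1, hb1, hc1⟩ := taylor_plane hf0 htaylor
  -- a box around the origin inside the domain
  obtain ⟨ε, hε, hbox⟩ : ∃ ε > 0, Set.Ioo (-ε) ε ×ˢ Set.Ioo (-ε) ε ⊆ Ω := by
    obtain ⟨ε, hε, hb⟩ := Metric.isOpen_iff.1 hΩ _ hΩ0
    refine ⟨ε, hε, fun z hz => hb ?_⟩
    rw [Metric.mem_ball, Prod.dist_eq, max_lt_iff, Real.dist_0_eq_abs, Real.dist_0_eq_abs, abs_lt,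
      abs_lt]
    exact hz
  set S : Set (ℝ × ℝ × ℝ) := Set.Ioo (-ε) ε ×ˢ Set.Ioo (-ε) ε ×ˢ Set.Ico 0 T with hS_def
  have h0I : (0 : ℝ) ∈ Set.Ioo (-ε) ε := ⟨by linarith, hε⟩
  have h0T : (0 : ℝ) ∈ Set.Ico 0 T := ⟨le_rfl, hT⟩
  have hS0 : (0 : ℝ × ℝ × ℝ) ∈ S := ⟨h0I, h0I, h0T⟩
  have hUS : ContDiffOn ℝ 2 U S := huC2.mono fun p hp => ⟨hbox ⟨hp.1, hp.2.1⟩, hp.2.2⟩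
  have hSu : UniqueDiffOn ℝ S :=
    (uniqueDiffOn_Ioo _ _).prod ((uniqueDiffOn_Ioo _ _).prod (uniqueDiffOn_Ico _ _))
  set D := fderivWithin ℝ U S with hD_def
  set D' := fderivWithin ℝ D S 0 with hD'_def
  have hD : ∀ z ∈ S, HasFDerivWithinAt U (D z) S z := fun z hz =>
    (hUS.differentiableOn (by simp) z hz).hasFDerivWithinAt
  have hD' : HasFDerivWithinAt D D' S 0 :=
    ((hUS.fderivWithin (m := 1) hSu (by norm_num)).differentiableOn (by simp) 0
      hS0).hasFDerivWithinAt
  have hsymm : ∀ v w, D' v w = D' w v := by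
    refine (hUS 0 hS0).isSymmSndFDerivWithinAt (by simp) hSu ?_ hS0
    rw [hS_def, interior_prod_eq, interior_prod_eq, closure_prod_eq, closure_prod_eq,
      interior_Ioo, interior_Ico, closure_Ioo (by linarith), closure_Ioo hT.ne]
    exact ⟨Set.Ioo_subset_Icc_self h0I, Set.Ioo_subset_Icc_self h0I, le_rfl, hT.le⟩
  -- spatial derivatives
  have hux : ∀ x y t : ℝ, (x, y, t) ∈ S →
      HasDerivAt (fun s => u s y t) (D (x, y, t) (1, 0, 0)) x := by
    intro x y t h
    have hl : HasDerivWithinAt (fun s : ℝ => (s, y, t)) (1, 0, 0) (Set.Ioo (-ε) ε) x :=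
      ((hasDerivAt_id x).prodMk (hasDerivAt_const x (y, t))).hasDerivWithinAt
    exact ((hD _ h).comp_hasDerivWithinAt_of_eq x hl (fun s hs => ⟨hs, h.2⟩) rfl).hasDerivAt
      (Ioo_mem_nhds h.1.1 h.1.2)
  have huy : ∀ x y t : ℝ, (x, y, t) ∈ S →
      HasDerivAt (fun s => u x s t) (D (x, y, t) (0, 1, 0)) y := by
    intro x y t h
    have hl : HasDerivWithinAt (fun s : ℝ => (x, s, t)) (0, 1, 0) (Set.Ioo (-ε) ε) y :=
      ((hasDerivAt_const y x).prodMk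
        ((hasDerivAt_id y).prodMk (hasDerivAt_const y t))).hasDerivWithinAt
    exact ((hD _ h).comp_hasDerivWithinAt_of_eq y hl (fun s hs => ⟨h.1, hs, h.2.2⟩) rfl).hasDerivAt
      (Ioo_mem_nhds h.2.1.1 h.2.1.2)
  have hut : ∀ x y t : ℝ, (x, y, t) ∈ S →
      HasDerivWithinAt (fun s => u x y s) (D (x, y, t) (0, 0, 1)) (Set.Ico 0 T) t := by
    intro x y t h
    have hl : HasDerivWithinAt (fun s : ℝ => (x, y, s)) (0, 0, 1) (Set.Ico 0 T) t :=
      ((hasDerivAt_const t x).prodMk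
        ((hasDerivAt_const t y).prodMk (hasDerivAt_id t))).hasDerivWithinAt
    exact (hD _ h).comp_hasDerivWithinAt_of_eq t hl (fun s hs => ⟨h.1, h.2.1, hs⟩) rfl
  have hux0 : ∀ x y : ℝ, (x, y, (0 : ℝ)) ∈ S →
      D (x, y, 0) (1, 0, 0) = fderiv ℝ f (x, y) (1, 0) := by
    intro x y h
    have hz : (x, y) ∈ Ω := hbox ⟨h.1, h.2.1⟩
    have hl : HasDerivAt (fun s : ℝ => (s, y)) (1, 0) x :=
      (hasDerivAt_id x).prodMk (hasDerivAt_const x y)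
    refine (hux x y 0 h).unique ((((hf3 _ hz).differentiableAt
      (by simp)).hasFDerivAt.comp_hasDerivAt x hl).congr_of_eventuallyEq ?_)
    filter_upwards [hl.continuousAt.eventually (hΩ.mem_nhds hz)] with s hs using hinit s y hs
  have huy0 : ∀ x y : ℝ, (x, y, (0 : ℝ)) ∈ S →
      D (x, y, 0) (0, 1, 0) = fderiv ℝ f (x, y) (0, 1) := by
    intro x y h
    have hz : (x, y) ∈ Ω := hbox ⟨h.1, h.2.1⟩
    have hl : HasDerivAt (fun s : ℝ => (x, s)) (0, 1) y :=
      (hasDerivAt_const y x).prodMk (hasDerivAt_id y)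
    refine (huy x y 0 h).unique ((((hf3 _ hz).differentiableAt
      (by simp)).hasFDerivAt.comp_hasDerivAt y hl).congr_of_eventuallyEq ?_)
    filter_upwards [hl.continuousAt.eventually (hΩ.mem_nhds hz)] with s hs using hinit x s hs
  -- derivatives of the initial datum along the diagonal
  have hdiag : HasDerivAt (fun s : ℝ => (s, s)) (1, 1) 0 :=
    (hasDerivAt_id (0 : ℝ)).prodMk (hasDerivAt_id (0 : ℝ))
  have hf1 : ContDiffAt ℝ 2 (fderiv ℝ f) 0 := hf0.fderiv_right (by norm_num)
  have hf2 : ContDiffAt ℝ 1 (fderiv ℝ (fderiv ℝ f)) 0 := hf1.fderiv_right (by norm_num)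
  have hd1s : ∀ w : ℝ × ℝ, HasDerivAt (fun s : ℝ => fderiv ℝ f (s, s) w)
      (fderiv ℝ (fderiv ℝ f) 0 (1, 1) w) 0 := fun w => by
    have h : HasDerivAt (fun s : ℝ => fderiv ℝ f (s, s)) (fderiv ℝ (fderiv ℝ f) 0 (1, 1)) 0 :=
      (hf1.differentiableAt (by simp)).hasFDerivAt.comp_hasDerivAt_of_eq (0 : ℝ) hdiag rfl
    simpa using h.clm_apply (hasDerivAt_const (0 : ℝ) w)
  have hd2s : ∀ v w : ℝ × ℝ, HasDerivAt (fun s : ℝ => fderiv ℝ (fderiv ℝ f) (s, s) v w)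
      (fderiv ℝ (fderiv ℝ (fderiv ℝ f)) 0 (1, 1) v w) 0 := fun v w => by
    have h : HasDerivAt (fun s : ℝ => fderiv ℝ (fderiv ℝ f) (s, s))
        (fderiv ℝ (fderiv ℝ (fderiv ℝ f)) 0 (1, 1)) 0 :=
      (hf2.differentiableAt (by simp)).hasFDerivAt.comp_hasDerivAt_of_eq (0 : ℝ) hdiag rfl
    simpa using (h.clm_apply (hasDerivAt_const (0 : ℝ) v)).clm_apply (hasDerivAt_const (0 : ℝ) w)
  have e11 : ((1, 1) : ℝ × ℝ) = (1, 0) + (0, 1) := by simp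
  have hpd : HasDerivAt (fun s : ℝ => fderiv ℝ f (s, s) (1, 0)) (2 * k₁) 0 :=
    (hd1s (1, 0)).congr_deriv (by rw [e11, map_add, add_apply, ha0, hc0, add_zero])
  have hqd : HasDerivAt (fun s : ℝ => fderiv ℝ f (s, s) (0, 1)) (2 * k₂) 0 :=
    (hd1s (0, 1)).congr_deriv (by rw [e11, map_add, add_apply, hb0, hd0, zero_add])
  have hdiv := hasDerivAt_divergence hφ hφ2one hα hpd hqd
    ((hd2s (1, 0) (1, 0)).congr_deriv ha1) ((hd2s (1, 0) (0, 1)).congr_deriv hb1)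
    ((hd2s (0, 1) (1, 0)).congr_deriv hc1) ((hd2s (0, 1) (0, 1)).congr_deriv hd1)
    hp0 hq0 ha0 hb0 hc0 hd0
  -- the time derivative of `u` along the diagonal
  have hmem : ∀ᶠ s in 𝓝 (0 : ℝ), (s, s, (0 : ℝ)) ∈ S := by
    filter_upwards [Ioo_mem_nhds h0I.1 h0I.2] with s hs using ⟨hs, hs, h0T⟩
  have hne : ∀ᶠ s in 𝓝 (0 : ℝ), 0 < fderiv ℝ f (s, s) (1, 0) :=
    hpd.continuousAt.eventually (lt_mem_nhds (by
      change 0 < fderiv ℝ f 0 (1, 0)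
      rwa [hp0]))
  have hDt := hdiv.congr_of_eventuallyEq (f₁ := fun s : ℝ => D (s, s, 0) (0, 0, 1)) (by
    filter_upwards [hmem, hne] with s hs hps
    have hz : (s, s) ∈ Ω := hbox ⟨hs.1, hs.2.1⟩
    have h1 := heq s s 0 hz h0T (Or.inl (by
      rw [(hux s s 0 hs).deriv, hux0 s s hs]; exact hps.ne'))
    rw [pmFlux_divergence hφ hΩ (hu₀C3.of_le (by norm_num)) hinit hz rfl rfl rfl rfl rfl rfl rfl
      (by positivity)] at h1
    exact (uniqueDiffOn_Ico 0 T 0 h0T).eq_deriv _ (hut s s 0 hs) h1)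
  have hD'diag : HasDerivAt (fun s : ℝ => D (s, s, 0) (0, 0, 1)) (D' (1, 1, 0) (0, 0, 1)) 0 := by
    have hl : HasDerivWithinAt (fun s : ℝ => (s, s, (0 : ℝ))) (1, 1, 0) (Set.Ioo (-ε) ε) 0 :=
      ((hasDerivAt_id (0 : ℝ)).prodMk
        ((hasDerivAt_id (0 : ℝ)).prodMk (hasDerivAt_const (0 : ℝ) (0 : ℝ)))).hasDerivWithinAt
    have h : HasDerivAt (fun s : ℝ => D (s, s, 0)) (D' (1, 1, 0)) 0 :=
      (hD'.comp_hasDerivWithinAt_of_eq (0 : ℝ) hl (fun s hs => ⟨hs, hs, h0T⟩) rfl).hasDerivAt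
        (Ioo_mem_nhds h0I.1 h0I.2)
    simpa using h.clm_apply (hasDerivAt_const (0 : ℝ) ((0, 0, 1) : ℝ × ℝ × ℝ))
  have hval := hD'diag.unique hDt
  -- the squared gradient at the origin as a function of time
  have hDtime : ∀ w : ℝ × ℝ × ℝ, HasDerivWithinAt (fun t : ℝ => D (0, 0, t) w)
      (D' (0, 0, 1) w) (Set.Ico 0 T) 0 := fun w => by
    have hl : HasDerivWithinAt (fun t : ℝ => ((0 : ℝ), (0 : ℝ), t)) (0, 0, 1) (Set.Ico 0 T) 0 :=
      ((hasDerivAt_const (0 : ℝ) (0 : ℝ)).prodMk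
        ((hasDerivAt_const (0 : ℝ) (0 : ℝ)).prodMk (hasDerivAt_id (0 : ℝ)))).hasDerivWithinAt
    have h : HasDerivWithinAt (fun t : ℝ => D (0, 0, t)) (D' (0, 0, 1)) (Set.Ico 0 T) 0 :=
      hD'.comp_hasDerivWithinAt_of_eq (0 : ℝ) hl (fun s hs => ⟨h0I, h0I, hs⟩) rfl
    simpa using h.clm_apply (hasDerivWithinAt_const (0 : ℝ) _ w)
  have hgrad : ∀ t ∈ Set.Ico 0 T,
      gradSqT u 0 0 t = D (0, 0, t) (1, 0, 0) ^ 2 + D (0, 0, t) (0, 1, 0) ^ 2 := fun t ht => by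
    rw [gradSqT, (hux 0 0 t ⟨h0I, h0I, ht⟩).deriv, (huy 0 0 t ⟨h0I, h0I, ht⟩).deriv]
  have hp00 : D (0, 0, 0) (1, 0, 0) = α := (hux0 0 0 hS0).trans hp0
  have hq00 : D (0, 0, 0) (0, 1, 0) = α := (huy0 0 0 hS0).trans hq0
  have hG : HasDerivWithinAt (fun t => gradSqT u 0 0 t) (2 * α * D' (1, 1, 0) (0, 0, 1))
      (Set.Ico 0 T) 0 := by
    refine ((((hDtime (1, 0, 0)).pow 2).add ((hDtime (0, 1, 0)).pow 2)).congr hgrad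
      (hgrad 0 h0T)).congr_deriv ?_
    have e110 : ((1, 1, 0) : ℝ × ℝ × ℝ) = (1, 0, 0) + (0, 1, 0) := by simp
    rw [hsymm (1, 1, 0), e110, map_add, hp00, hq00]
    push_cast
    ring
  refine exists_one_lt_of_hasDerivWithinAt hT hG ?_ ?_
  · rw [hgrad 0 h0T, hp00, hq00]
    linarith
  · rw [hval]
    rw [hsq] at hpos
    refine mul_pos (by positivity) (mul_pos hα0 ?_)
    linarith
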